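/- For all real numbers α and β, not both zero, the function h ↦ α Ī₂(h) + β √(1+h) has at most one zero in the interval (−1,0). -/

import Mathlib

open intervalIntegral Real

/-- `Ī_k(h) = ∫_{u₁(h)}^{u₂(h)} u^k √(h + 2u² − u⁴) du` where
`u₁(h) = √(1 − √(1+h))` and `u₂(h) = √(1 + √(1+h))`. -/
noncomputable def Ibar (k : ℕ) (h : ℝ) : ℝ :=
  ∫ u in (Real.sqrt (1 - Real.sqrt (1 + h)))..(Real.sqrt (1 + Real.sqrt (1 + h))),
    u ^ k * Real.sqrt (h + 2 * u ^ 2 - u ^ 4)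

/-- The integral `∫_{-1}^{1} √(1 + c t) √(1 - t²) dt`, to which `Ibar 2` reduces. -/
noncomputable def weightedSqrtIntegral (c : ℝ) : ℝ :=
  ∫ t in (-1 : ℝ)..1, √(1 + c * t) * √(1 - t ^ 2)

/-- The substitution `u² = 1 + c t` with `c = √(1 + h)`. -/
lemma Ibar_two_eq {h : ℝ} (hh : h ∈ Set.Ioo (-1 : ℝ) 0) :
    Ibar 2 h = √(1 + h) ^ 2 / 2 * weightedSqrtIntegral √(1 + h) := by
  have hsq : √(1 + h) ^ 2 = 1 + h := Real.sq_sqrt (by linarith [hh.1])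
  have hc0 : 0 ≤ √(1 + h) := Real.sqrt_nonneg _
  have hc1 : √(1 + h) < 1 := by
    rw [Real.sqrt_lt' one_pos]; linarith [hh.2]
  unfold Ibar weightedSqrtIntegral
  set c := √(1 + h) with hc
  have hpos : ∀ t ∈ Set.uIcc (-1 : ℝ) 1, 0 < 1 + c * t := by
    intro t ht
    rw [Set.uIcc_of_le (by norm_num)] at ht
    nlinarith [ht.1, ht.2]
  have key := integral_comp_mul_deriv (a := -1) (b := 1) (f := fun t : ℝ => √(1 + c * t))
    (f' := fun t => c / (2 * √(1 + c * t)))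
    (g := fun u => u ^ 2 * √(h + 2 * u ^ 2 - u ^ 4))
    (fun t ht => by
      have h1 : HasDerivAt (fun t : ℝ => 1 + c * t) c t := by
        simpa using ((hasDerivAt_id t).const_mul c).const_add 1
      exact h1.sqrt (hpos t ht).ne')
    (by
      refine ContinuousOn.div (by fun_prop) (by fun_prop) fun t ht => ?_
      have := Real.sqrt_pos.2 (hpos t ht)
      positivity)
    (by fun_prop)
  simp only [mul_neg, mul_one, ← sub_eq_add_neg] at key
  rw [← key, ← integral_const_mul]
  refine integral_congr fun t ht => ?_
  have hp := hpos t ht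
  have hs := Real.sqrt_pos.2 hp
  have hs2 : √(1 + c * t) ^ 2 = 1 + c * t := Real.sq_sqrt hp.le
  have hs4 : √(1 + c * t) ^ 4 = (1 + c * t) ^ 2 := by
    rw [show √(1 + c * t) ^ 4 = (√(1 + c * t) ^ 2) ^ 2 by ring, hs2]
  have harg : h + 2 * (1 + c * t) - (1 + c * t) ^ 2 = c ^ 2 * (1 - t ^ 2) := by
    linear_combination -hsq
  simp only [Function.comp_apply]
  rw [hs4, hs2, harg, Real.sqrt_mul (sq_nonneg c), Real.sqrt_sq hc0]
  field_simp
  linear_combination (-(c ^ 2) * √(1 - t ^ 2)) * hs2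

/-- A secant bound for the even function `x ↦ √(1 + x) + √(1 - x)` on `[0, 1)`. -/
lemma sqrt_add_sqrt_secant {x y z : ℝ} (hx : 0 ≤ x) (hxy : x ≤ y) (hyz : y ≤ z) (hz : z < 1) :
    (y - x) * (1 / (2 * √(1 + z)) - 1 / (2 * √(1 - z))) ≤
      (√(1 + y) + √(1 - y)) - (√(1 + x) + √(1 - x)) := by
  have a1 : 0 < √(1 + x) := Real.sqrt_pos.2 (by linarith)
  have a2 : 0 < √(1 + y) := Real.sqrt_pos.2 (by linarith)
  have a3 : 0 < √(1 - z) := Real.sqrt_pos.2 (by linarith)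
  have b1 : √(1 + x) ≤ √(1 + z) := Real.sqrt_le_sqrt (by linarith)
  have b2 : √(1 + y) ≤ √(1 + z) := Real.sqrt_le_sqrt (by linarith)
  have b3 : √(1 - z) ≤ √(1 - x) := Real.sqrt_le_sqrt (by linarith)
  have b4 : √(1 - z) ≤ √(1 - y) := Real.sqrt_le_sqrt (by linarith)
  have e1 : √(1 + y) - √(1 + x) = (y - x) * (1 / (√(1 + x) + √(1 + y))) := by
    field_simp
    linear_combination Real.sq_sqrt (show 0 ≤ 1 + y by linarith) -
      Real.sq_sqrt (show 0 ≤ 1 + x by linarith)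
  have e2 : √(1 - x) - √(1 - y) = (y - x) * (1 / (√(1 - x) + √(1 - y))) := by
    have : 0 < √(1 - x) + √(1 - y) := by linarith
    field_simp
    linear_combination Real.sq_sqrt (show 0 ≤ 1 - x by linarith) -
      Real.sq_sqrt (show 0 ≤ 1 - y by linarith)
  have i1 : 1 / (2 * √(1 + z)) ≤ 1 / (√(1 + x) + √(1 + y)) :=
    one_div_le_one_div_of_le (by linarith) (by linarith)
  have i2 : 1 / (√(1 - x) + √(1 - y)) ≤ 1 / (2 * √(1 - z)) :=
    one_div_le_one_div_of_le (by linarith) (by linarith)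
  have j1 := mul_le_mul_of_nonneg_left i1 (sub_nonneg.2 hxy)
  have j2 := mul_le_mul_of_nonneg_left i2 (sub_nonneg.2 hxy)
  linarith

/-- The concave function `c ↦ c (√(1 + c t) + √(1 - c t))` has slopes on `[0, 1]` at least its
derivative at `1`; here both sides are multiplied by `√(1 - t²)`. -/
lemma slope_lower_bound_of_nonneg {a b t : ℝ} (ha : 0 ≤ a) (hab : a ≤ b) (hb : b ≤ 1)
    (ht0 : 0 ≤ t) (ht1 : t < 1) :
    (b - a) * (((2 + 3 * t) * √(1 - t) + (2 - 3 * t) * √(1 + t)) / 2) ≤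
      (b * (√(1 + b * t) + √(1 - b * t)) - a * (√(1 + a * t) + √(1 - a * t))) *
        √(1 - t ^ 2) := by
  have hat : 0 ≤ a * t := by positivity
  have habt : a * t ≤ b * t := mul_le_mul_of_nonneg_right hab ht0
  have hbt : b * t ≤ t := mul_le_of_le_one_left ht0 hb
  have hR : 0 < √(1 - t) := Real.sqrt_pos.2 (by linarith)
  have hRS : √(1 - t) ≤ √(1 + t) := Real.sqrt_le_sqrt (by linarith)
  have hS : 0 < √(1 + t) := hR.trans_le hRS
  have R2 : √(1 - t) ^ 2 = 1 - t := Real.sq_sqrt (by linarith)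
  have S2 : √(1 + t) ^ 2 = 1 + t := Real.sq_sqrt (by linarith)
  have hprod : √(1 - t ^ 2) = √(1 - t) * √(1 + t) := by
    rw [← Real.sqrt_mul (by linarith)]; ring_nf
  have k1 := sqrt_add_sqrt_secant hat habt hbt ht1
  have k2 : √(1 + t) + √(1 - t) ≤ √(1 + b * t) + √(1 - b * t) := by
    have hbt0 : 0 ≤ b * t := hat.trans habt
    have q1 : 1 - t ^ 2 ≤ 1 - (b * t) ^ 2 := by nlinarith
    have q2 := Real.sqrt_le_sqrt q1
    have q3 : √(1 - (b * t) ^ 2) = √(1 - b * t) * √(1 + b * t) := by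
      rw [← Real.sqrt_mul (by linarith)]; ring_nf
    have q4 : √(1 - b * t) ^ 2 = 1 - b * t := Real.sq_sqrt (by linarith)
    have q5 : √(1 + b * t) ^ 2 = 1 + b * t := Real.sq_sqrt (by linarith)
    rw [hprod, q3] at q2
    refine le_of_sq_le_sq ?_ (by positivity)
    nlinarith
  set S := √(1 + t)
  set R := √(1 - t)
  set d := 1 / (2 * S) - 1 / (2 * R) with hd
  have hd0 : d ≤ 0 := by
    rw [hd, sub_nonpos]
    exact one_div_le_one_div_of_le (by linarith) (by linarith)
  have k3 : (b - a) * (S + R + t * d) ≤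
      b * (√(1 + b * t) + √(1 - b * t)) - a * (√(1 + a * t) + √(1 - a * t)) := by
    have m1 := mul_le_mul_of_nonneg_left k1 ha
    have m2 := mul_le_mul_of_nonneg_left k2 (sub_nonneg.2 hab)
    have m3 : 0 ≤ (b - a) * ((1 - a) * (t * -d)) :=
      mul_nonneg (by linarith) (mul_nonneg (by linarith) (mul_nonneg ht0 (by linarith)))
    nlinarith
  have k4 : (S + R + t * d) * (R * S) = ((2 + 3 * t) * R + (2 - 3 * t) * S) / 2 := by
    rw [hd]
    field_simp
    linear_combination (2 * R) * S2 + (2 * S) * R2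
  rw [hprod, ← k4, ← mul_assoc]
  exact mul_le_mul_of_nonneg_right k3 (by positivity)

lemma slope_lower_bound {a b t : ℝ} (ha : 0 ≤ a) (hab : a ≤ b) (hb : b ≤ 1)
    (ht : t ∈ Set.Ioo (-1 : ℝ) 1) :
    (b - a) * (((2 + 3 * t) * √(1 - t) + (2 - 3 * t) * √(1 + t)) / 2) ≤
      (b * (√(1 + b * t) + √(1 - b * t)) - a * (√(1 + a * t) + √(1 - a * t))) *
        √(1 - t ^ 2) := by
  rcases le_total 0 t with h0 | h0
  · exact slope_lower_bound_of_nonneg ha hab hb h0 ht.2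
  · have := slope_lower_bound_of_nonneg ha hab hb (neg_nonneg.2 h0) (by linarith [ht.1])
    simp only [mul_neg, sub_neg_eq_add, ← sub_eq_add_neg, neg_sq] at this
    convert this using 2 <;> ring

lemma integral_two_add_three_mul_sqrt_pos :
    0 < ∫ t in (-1 : ℝ)..1, (2 + 3 * t) * √(1 - t) := by
  have key : ∫ t in (-1 : ℝ)..1, (2 + 3 * t) * √(1 - t) =
      -((1 - 1) * (10 / 3 - 6 / 5 * (1 - 1)) * √(1 - 1)) -
        -((1 - (-1)) * (10 / 3 - 6 / 5 * (1 - (-1))) * √(1 - (-1))) := by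
    refine integral_eq_sub_of_hasDerivAt_of_le
      (f := fun t : ℝ => -((1 - t) * (10 / 3 - 6 / 5 * (1 - t)) * √(1 - t)))
      (by norm_num) (by fun_prop) (fun t ht => ?_)
      (Continuous.intervalIntegrable (by fun_prop) _ _)
    have hp : 0 < 1 - t := by linarith [ht.2]
    have h1 : HasDerivAt (fun t : ℝ => 1 - t) (-1) t := by
      simpa using (hasDerivAt_id t).const_sub 1
    have h2 := ((h1.mul ((h1.const_mul (6 / 5)).const_sub (10 / 3))).mul (h1.sqrt hp.ne')).neg
    refine h2.congr_deriv ?_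
    have hs := Real.sqrt_pos.2 hp
    have hs2 : √(1 - t) ^ 2 = 1 - t := Real.sq_sqrt hp.le
    simp only [Pi.mul_apply]
    field_simp
    rw [hs2]
    ring
  rw [key]
  norm_num

lemma strictMonoOn_mul_weightedSqrtIntegral :
    StrictMonoOn (fun c => c * weightedSqrtIntegral c) (Set.Icc 0 1) := by
  intro a ha b hb hab
  have hsymm : ∀ c : ℝ, ∫ t in (-1 : ℝ)..1, √(1 - c * t) * √(1 - t ^ 2) =
      weightedSqrtIntegral c := by
    intro c
    have := integral_comp_neg (a := -1) (b := 1) fun t : ℝ => √(1 + c * t) * √(1 - t ^ 2)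
    simpa [weightedSqrtIntegral, ← sub_eq_add_neg] using this
  have hsum : ∀ c : ℝ, ∫ t in (-1 : ℝ)..1,
      c * (√(1 + c * t) + √(1 - c * t)) * √(1 - t ^ 2) = 2 * (c * weightedSqrtIntegral c) := by
    intro c
    have : ∀ t : ℝ, c * (√(1 + c * t) + √(1 - c * t)) * √(1 - t ^ 2) =
        c * (√(1 + c * t) * √(1 - t ^ 2) + √(1 - c * t) * √(1 - t ^ 2)) := fun t => by ring
    simp only [this]
    rw [integral_const_mul, integral_add (Continuous.intervalIntegrable (by fun_prop) _ _)
      (Continuous.intervalIntegrable (by fun_prop) _ _), hsymm, ← weightedSqrtIntegral]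
    ring
  have hleft : ∫ t in (-1 : ℝ)..1,
      (b - a) * (((2 + 3 * t) * √(1 - t) + (2 - 3 * t) * √(1 + t)) / 2) =
      (b - a) * ∫ t in (-1 : ℝ)..1, (2 + 3 * t) * √(1 - t) := by
    have := integral_comp_neg (a := -1) (b := 1) fun t : ℝ => (2 + 3 * t) * √(1 - t)
    simp only [mul_neg, sub_neg_eq_add, ← sub_eq_add_neg, neg_neg] at this
    rw [integral_const_mul, integral_div,
      integral_add (Continuous.intervalIntegrable (by fun_prop) _ _)
      (Continuous.intervalIntegrable (by fun_prop) _ _), this]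
    ring
  have hmono := integral_mono_on_of_le_Ioo (a := -1) (b := 1) (μ := MeasureTheory.volume)
    (by norm_num) (Continuous.intervalIntegrable (by fun_prop) _ _)
    (Continuous.intervalIntegrable (by fun_prop) _ _)
    fun t ht => slope_lower_bound ha.1 hab.le hb.2 ht
  simp only [sub_mul (b * _)] at hmono
  rw [hleft, integral_sub (Continuous.intervalIntegrable (by fun_prop) _ _)
    (Continuous.intervalIntegrable (by fun_prop) _ _), hsum, hsum] at hmono
  have := mul_pos (sub_pos.2 hab) integral_two_add_three_mul_sqrt_pos
  show a * weightedSqrtIntegral a < b * weightedSqrtIntegral b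
  linarith

/-- For reals `α, β` not both zero, the function
`h ↦ α Ī₂(h) + β √(1+h)` has at most one zero in `(−1,0)`. -/
theorem stmt17 (α β : ℝ) (hne : ¬ (α = 0 ∧ β = 0)) :
    ∀ T : Finset ℝ,
      (∀ h ∈ T, h ∈ Set.Ioo (-1 : ℝ) 0 ∧
        α * Ibar 2 h + β * Real.sqrt (1 + h) = 0) →
      T.card ≤ 1 := by
  intro T hT
  have hzero : ∀ h ∈ T, √(1 + h) ∈ Set.Icc (0 : ℝ) 1 ∧
      α * (√(1 + h) * weightedSqrtIntegral √(1 + h)) + 2 * β = 0 := by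
    intro h hh
    obtain ⟨hI, heq⟩ := hT h hh
    have hc : 0 < √(1 + h) := Real.sqrt_pos.2 (by linarith [hI.1])
    refine ⟨⟨hc.le, Real.sqrt_le_one.2 (by linarith [hI.2])⟩, ?_⟩
    rw [Ibar_two_eq hI] at heq
    refine (mul_eq_zero.1 ?_).resolve_left hc.ne'
    linear_combination 2 * heq
  rw [Finset.card_le_one]
  intro x hx y hy
  have hα : α ≠ 0 := by
    rintro rfl
    exact hne ⟨rfl, by linarith [(hzero x hx).2]⟩
  obtain ⟨hx1, hx2⟩ := hzero x hx
  obtain ⟨hy1, hy2⟩ := hzero y hy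
  have hxy := strictMonoOn_mul_weightedSqrtIntegral.injOn hx1 hy1
    (mul_left_cancel₀ hα (by linarith))
  rw [Real.sqrt_inj (by linarith [(hT x hx).1.1]) (by linarith [(hT y hy).1.1])] at hxy
  linarith
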